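/- Let d ≥ 1, let 0 < p < p' < 1, and let L be a subgroup of ℤ^d generated by d−1 linearly independent vectors (a (d−1)-dimensional lattice of shifts). Then there exists a discrete thickening from density p to density p' on {0,1}^{ℤ^d} which commutes with σ_v for every v ∈ L. -/

import Mathlib

open MeasureTheory ProbabilityTheory

/-- The Bernoulli measure on `Bool` assigning mass `r` to `true`. -/
noncomputable def bernoulliMeasure (r : ℝ) : Measure Bool :=
  ENNReal.ofReal r • Measure.dirac true + ENNReal.ofReal (1 - r) • Measure.dirac false

/-- `μ` is the product of Bernoulli(`r`) measures over the index set `I`: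
it is a probability measure whose finite-dimensional marginals are i.i.d. Bernoulli(`r`). -/
def IsBernoulliProduct {I : Type*} (r : ℝ) (μ : Measure (I → Bool)) : Prop :=
  IsProbabilityMeasure μ ∧
    ∀ (s : Finset I) (b : I → Bool),
      μ {x | ∀ i ∈ s, x i = b i} =
        ∏ i ∈ s, (if b i then ENNReal.ofReal r else ENNReal.ofReal (1 - r))

section Bernoulli

lemma bernoulliMeasure_singleton (r : ℝ) (b : Bool) :
    bernoulliMeasure r {b} = if b then ENNReal.ofReal r else ENNReal.ofReal (1 - r) := by
  cases b <;> simp [_root_.bernoulliMeasure]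

lemma isProbabilityMeasure_bernoulliMeasure {r : ℝ} (h0 : 0 ≤ r) (h1 : r ≤ 1) :
    IsProbabilityMeasure (bernoulliMeasure r) := by
  refine ⟨?_⟩
  simp only [_root_.bernoulliMeasure, Measure.add_apply, Measure.smul_apply, measure_univ, smul_eq_mul,
    mul_one]
  rw [← ENNReal.ofReal_add h0 (by linarith)]
  simp

lemma isBernoulliProduct_infinitePi {I : Type*} (r : ℝ)
    [IsProbabilityMeasure (bernoulliMeasure r)] :
    IsBernoulliProduct r (Measure.infinitePi fun _ : I => bernoulliMeasure r) := by
  refine ⟨inferInstance, fun s b => ?_⟩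
  have := Measure.infinitePi_pi (fun _ : I => bernoulliMeasure r) (s := s) (t := fun i => {b i})
    (fun _ _ => MeasurableSet.singleton _)
  simp only [bernoulliMeasure_singleton] at this
  exact this

lemma IsBernoulliProduct.eq_infinitePi {I : Type*} {r : ℝ}
    [IsProbabilityMeasure (bernoulliMeasure r)] {μ : Measure (I → Bool)}
    (h : IsBernoulliProduct r μ) :
    μ = Measure.infinitePi fun _ : I => bernoulliMeasure r := by
  refine (Measure.isProjectiveLimit_infinitePi (fun _ : I => bernoulliMeasure r)).unique ?_ |>.symm
  intro s
  refine Measure.ext_of_singleton fun y => ?_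
  classical
  rw [Measure.map_apply (by fun_prop) (MeasurableSet.singleton _), Measure.pi_singleton]
  have := h.2 s (fun i => if hi : i ∈ s then y ⟨i, hi⟩ else false)
  rw [← Finset.prod_attach] at this
  simp only [Finset.coe_mem, dite_true] at this
  simp only [bernoulliMeasure_singleton]
  rw [Finset.univ_eq_attach, ← this]
  congr 1
  ext x
  simp only [Set.mem_preimage, Set.mem_singleton_iff, Set.mem_ofPred_eq, funext_iff,
    Finset.restrict, Subtype.forall]
  refine forall_congr' fun i => forall_congr' fun hi => ?_
  simp [hi]

end Bernoulli

section Uniform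

lemma measure_cdf_le (ρ : Measure ℝ) [IsProbabilityMeasure ρ] [NullSingletonClass ρ] {u : ℝ}
    (hu0 : 0 ≤ u) (hu1 : u ≤ 1) : ρ {x | cdf ρ x ≤ u} = ENNReal.ofReal u := by
  have hcont : Continuous (cdf ρ) := by
    refine continuous_iff_continuousAt.2 fun x => ?_
    rw [(monotone_cdf ρ).continuousAt_iff_leftLim_eq_rightLim, StieltjesFunction.rightLim_eq]
    have h := (cdf ρ).measure_singleton x
    rw [measure_cdf, measure_singleton, eq_comm, ENNReal.ofReal_eq_zero] at h
    exact le_antisymm ((monotone_cdf ρ).leftLim_le le_rfl) (by linarith)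
  have hsurj : ∀ v : ℝ, 0 < v → v < 1 → ∃ t, cdf ρ t = v := fun v h0 h1 => by
    refine mem_range_of_exists_le_of_exists_ge hcont ?_ ?_
    · exact ((tendsto_cdf_atBot ρ).eventually (eventually_le_nhds h0)).exists
    · exact ((tendsto_cdf_atTop ρ).eventually (eventually_ge_nhds h1)).exists
  rcases hu1.eq_or_lt with rfl | hu1
  · simp [cdf_le_one]
  refine le_antisymm ?_ ?_
  · refine ENNReal.le_of_forall_pos_le_add fun ε hε _ => ?_
    set v := min (u + ε) ((u + 1) / 2)
    have hε' : (0 : ℝ) < ε := hε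
    have huv : u < v := lt_min (by linarith) (by linarith)
    obtain ⟨t, ht⟩ := hsurj v (by linarith) ((min_le_right _ _).trans_lt (by linarith))
    calc ρ {x | cdf ρ x ≤ u} ≤ ρ (Set.Iic t) := by
          refine measure_mono fun x hx => ?_
          by_contra hxt
          have := monotone_cdf ρ (not_le.1 hxt).le
          rw [Set.mem_ofPred_eq] at hx
          linarith
      _ = ENNReal.ofReal v := by rw [← ofReal_cdf, ht]
      _ ≤ ENNReal.ofReal (u + ε) := ENNReal.ofReal_le_ofReal (min_le_left _ _)
      _ = ENNReal.ofReal u + ε := by rw [ENNReal.ofReal_add hu0 hε'.le, ENNReal.ofReal_coe_nnreal]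
  · rcases hu0.eq_or_lt with rfl | hu0
    · simp
    obtain ⟨t, ht⟩ := hsurj u hu0 hu1
    rw [← ht, ofReal_cdf]
    exact measure_mono fun x hx => monotone_cdf ρ hx

lemma exists_measurable_map_eq_volume_unitInterval {Ω : Type*} [MeasurableSpace Ω]
    [StandardBorelSpace Ω] (μ : Measure Ω) [IsProbabilityMeasure μ] [NullSingletonClass μ] :
    ∃ f : Ω → unitInterval, Measurable f ∧ μ.map f = volume := by
  have he := measurableEmbedding_embeddingReal Ω
  set ρ := μ.map (embeddingReal Ω)
  have : IsProbabilityMeasure ρ := Measure.isProbabilityMeasure_map he.measurable.aemeasurable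
  have : NullSingletonClass ρ := by
    refine ⟨fun x => ?_⟩
    rw [Measure.map_apply he.measurable (MeasurableSet.singleton _)]
    exact (Set.subsingleton_singleton.preimage he.injective).measure_zero μ
  have hm : Measurable (cdf ρ) := (monotone_cdf ρ).measurable
  refine ⟨fun ω => ⟨cdf ρ (embeddingReal Ω ω), cdf_nonneg _ _, cdf_le_one _ _⟩, ?_, ?_⟩
  · exact (hm.comp he.measurable).subtype_mk
  · have hm' : Measurable fun ω =>
      (⟨cdf ρ (embeddingReal Ω ω), cdf_nonneg _ _, cdf_le_one _ _⟩ : unitInterval) :=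
      (hm.comp he.measurable).subtype_mk
    have := Measure.isProbabilityMeasure_map (μ := μ) hm'.aemeasurable
    refine Measure.ext_of_Iic _ _ fun u => ?_
    rw [Measure.map_apply hm' measurableSet_Iic, unitInterval.volume_Iic,
      ← measure_cdf_le ρ u.2.1 u.2.2,
      Measure.map_apply he.measurable (measurableSet_le hm measurable_const)]
    rfl

lemma nullSingletonClass_infinitePi_of_le {α : Type*} [MeasurableSpace α] [MeasurableSingletonClass α]
    (ν : Measure α) [IsProbabilityMeasure ν] {c : ENNReal} (hc : c < 1) (h : ∀ a, ν {a} ≤ c) :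
    NullSingletonClass (Measure.infinitePi fun _ : ℕ => ν) := by
  refine ⟨fun x => ?_⟩
  refine le_antisymm ?_ zero_le
  refine ge_of_tendsto' (ENNReal.tendsto_pow_atTop_nhds_zero_of_lt_one hc) fun n => ?_
  calc Measure.infinitePi (fun _ : ℕ => ν) {x}
      ≤ Measure.infinitePi (fun _ : ℕ => ν) (Set.pi (Finset.range n) fun i => {x i}) :=
        measure_mono (by rintro _ rfl; simp [Set.mem_pi])
    _ = ∏ i ∈ Finset.range n, ν {x i} :=
        Measure.infinitePi_pi _ fun _ _ => MeasurableSet.singleton _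
    _ ≤ ∏ i ∈ Finset.range n, c := Finset.prod_le_prod' fun i _ => h _
    _ = c ^ n := by simp

end Uniform

section Zip

lemma map_zip_infinitePi {ι α β : Type*} [MeasurableSpace α] [MeasurableSpace β]
    [Countable ι] (μ : Measure α) (ν : Measure β) [IsProbabilityMeasure μ] [IsProbabilityMeasure ν] :
    ((Measure.infinitePi fun _ : ι => μ).prod (Measure.infinitePi fun _ : ι => ν)).map
      (fun z i => (z.1 i, z.2 i)) = Measure.infinitePi fun _ : ι => μ.prod ν := by
  refine Measure.eq_infinitePi _ fun s t ht => ?_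
  have hm : Measurable fun (z : (ι → α) × (ι → β)) i => (z.1 i, z.2 i) := by fun_prop
  have hms : MeasurableSet (Set.pi (s : Set ι) t) :=
    .pi s.countable_toSet fun _ _ => ht _
  rw [Measure.map_apply hm hms, Measure.prod_apply (hm hms)]
  have key : ∀ x : ι → α, (Measure.infinitePi fun _ : ι => ν)
      (Prod.mk x ⁻¹' ((fun (z : (ι → α) × (ι → β)) i => (z.1 i, z.2 i)) ⁻¹' Set.pi (s : Set ι) t))
      = ∏ i ∈ s, ν (Prod.mk (x i) ⁻¹' t i) := fun x => by
    rw [← Measure.infinitePi_pi (fun _ : ι => ν) (t := fun i => Prod.mk (x i) ⁻¹' t i)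
      (fun i _ => measurable_prodMk_left (ht i))]
    rfl
  simp_rw [key]
  rw [lintegral_prod_eq_prod_lintegral_of_indepFun s (fun i (x : ι → α) => ν (Prod.mk (x i) ⁻¹' t i))
    (iIndepFun_infinitePi (X := fun i a => ν (Prod.mk a ⁻¹' t i))
      fun i => measurable_measure_prodMk_left (ht i))
    fun i => (measurable_measure_prodMk_left (ht i)).comp (measurable_pi_apply i)]
  refine Finset.prod_congr rfl fun i _ => ?_
  rw [Measure.prod_apply (ht i), ← (measurePreserving_eval_infinitePi (fun _ : ι => μ) i).lintegral_comp
    (measurable_measure_prodMk_left (ht i))]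

end Zip

section FiniteCoupling

/-- The probability of a word under independent Bernoulli(`r`) letters. -/
def wordWeight (r : ℝ) {n : ℕ} (x : Fin n → Bool) : ℝ := ∏ i, if x i then r else 1 - r

/-- The transition weight that keeps `true` and turns `false` into `true` with weight `ε`. -/
def letterKernel (ε : ℝ) (a b : Bool) : ℝ :=
  if a then (if b then 1 else 0) else (if b then ε else 1 - ε)

/-- The letterwise product of `letterKernel`. -/
def wordKernel (ε : ℝ) {n : ℕ} (x y : Fin n → Bool) : ℝ := ∏ i, letterKernel ε (x i) (y i)

/-- The word whose only `false` letter is at position `i`. -/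
def holeWord {n : ℕ} (i : Fin n) : Fin n → Bool := fun j => decide (j ≠ i)

/-- The mass moved from the all-`true` word to `holeWord i` in the row of `x`. -/
noncomputable def holeShift (ε t : ℝ) {n : ℕ} (i j : Fin n) (x : Fin n → Bool) : ℝ :=
  if x = holeWord i then -(1 - ε)
  else if x i = false ∧ x j = true then t * wordKernel ε x ⊤ else 0

variable {n : ℕ} {ε t : ℝ}

lemma wordKernel_nonneg (h0 : 0 ≤ ε) (h1 : ε ≤ 1) (x y : Fin n → Bool) :
    0 ≤ wordKernel ε x y := by
  refine Finset.prod_nonneg fun i _ => ?_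
  unfold letterKernel
  split_ifs <;> linarith

lemma le_of_wordKernel_ne_zero {x y : Fin n → Bool} (h : wordKernel ε x y ≠ 0) : x ≤ y := by
  intro i
  have := Finset.prod_ne_zero_iff.1 h i (Finset.mem_univ i)
  revert this
  unfold letterKernel
  cases x i <;> cases y i <;> simp

lemma sum_prod_word (h : Fin n → Bool → ℝ) :
    ∑ x : Fin n → Bool, ∏ i, h i (x i) = ∏ i, (h i true + h i false) := by
  have := Finset.sum_prod_piFinset (Finset.univ : Finset Bool) h
  simp only [Fintype.piFinset_univ, Fintype.sum_bool] at this
  exact this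

lemma sum_wordKernel (x : Fin n → Bool) : ∑ y, wordKernel ε x y = 1 := by
  unfold wordKernel
  rw [sum_prod_word fun i b => letterKernel ε (x i) b]
  refine Finset.prod_eq_one fun i _ => ?_
  unfold letterKernel
  cases x i <;> simp

lemma sum_wordWeight_mul_wordKernel (p : ℝ) (y : Fin n → Bool) :
    ∑ x, wordWeight p x * wordKernel ε x y = wordWeight (p + (1 - p) * ε) y := by
  unfold wordKernel wordWeight
  simp_rw [← Finset.prod_mul_distrib]
  rw [sum_prod_word fun i b => (if b then p else 1 - p) * letterKernel ε b (y i)]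
  refine Finset.prod_congr rfl fun i _ => ?_
  unfold letterKernel
  cases y i <;> simp
  ring

lemma holeWord_self (i : Fin n) : holeWord i i = false := by simp [holeWord]

lemma holeWord_of_ne {i j : Fin n} (h : j ≠ i) : holeWord i j = true := by simp [holeWord, h]

lemma holeWord_injective : Function.Injective (holeWord : Fin n → Fin n → Bool) := by
  intro i j h
  by_contra hij
  have := congrFun h i
  rw [holeWord_self, holeWord_of_ne hij] at this
  exact absurd this (by simp)

lemma holeWord_ne_top (i : Fin n) : holeWord i ≠ ⊤ := fun h => by
  have := congrFun h i
  rw [holeWord_self] at this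
  exact absurd this (by simp)

lemma wordKernel_holeWord (i : Fin n) (y : Fin n → Bool) :
    wordKernel ε (holeWord i) y =
      (if y = ⊤ then ε else 0) + (if y = holeWord i then 1 - ε else 0) := by
  by_cases hy : ∃ j, j ≠ i ∧ y j = false
  · obtain ⟨j, hji, hj⟩ := hy
    rw [if_neg, if_neg, wordKernel, Finset.prod_eq_zero (Finset.mem_univ j)]
    · simp
    · simp [letterKernel, holeWord_of_ne hji, hj]
    · rintro rfl
      simp [holeWord_of_ne hji] at hj
    · rintro rfl
      simp at hj
  · push Not at hy
    have hy' : ∀ j, j ≠ i → y j = true := fun j hj => by simpa using hy j hj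
    have hk : wordKernel ε (holeWord i) y = letterKernel ε false (y i) := by
      rw [wordKernel, Finset.prod_eq_single i, holeWord_self]
      · intro j _ hj
        simp [letterKernel, holeWord_of_ne hj, hy' j hj]
      · simp
    cases hi : y i
    · have : y = holeWord i := by
        ext j
        by_cases hj : j = i
        · subst hj; rw [hi, holeWord_self]
        · rw [hy' j hj, holeWord_of_ne hj]
      rw [hk, hi, if_pos this, if_neg (this ▸ holeWord_ne_top i)]
      simp [letterKernel]
    · have : y = ⊤ := by
        ext j
        by_cases hj : j = i
        · subst hj; simp [hi]
        · simp [hy' j hj]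
      rw [hk, hi, if_pos this, if_neg (this ▸ (holeWord_ne_top i).symm)]
      simp [letterKernel]

lemma wordWeight_holeWord (p : ℝ) (i : Fin (n + 1)) :
    wordWeight p (holeWord i) = (1 - p) * p ^ n := by
  rw [wordWeight, Fin.prod_univ_succAbove _ i, holeWord_self]
  simp [holeWord_of_ne]

lemma sum_wordWeight_mul_wordKernel_top (p : ℝ) {i j : Fin (n + 2)} (hij : i ≠ j) :
    ∑ x : Fin (n + 2) → Bool,
      (if x i = false ∧ x j = true then wordWeight p x * wordKernel ε x ⊤ else 0) =
      (1 - p) * ε * p * (p + (1 - p) * ε) ^ n := by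
  have h : ∀ x : Fin (n + 2) → Bool,
      (if x i = false ∧ x j = true then wordWeight p x * wordKernel ε x ⊤ else 0) =
      ∏ l, ((if x l then p else 1 - p) * letterKernel ε (x l) true *
        ((if l = i ∧ x l = true then 0 else 1) * (if l = j ∧ x l = false then 0 else 1))) := by
    intro x
    split_ifs with hx
    · unfold wordWeight wordKernel
      rw [← Finset.prod_mul_distrib]
      refine Finset.prod_congr rfl fun l _ => ?_
      have h1 : ¬(l = i ∧ x l = true) := by rintro ⟨rfl, h⟩; simp [hx.1] at h
      have h2 : ¬(l = j ∧ x l = false) := by rintro ⟨rfl, h⟩; simp [hx.2] at h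
      simp only [h1, h2, if_false, mul_one]
      rfl
    · by_cases hi : x i = false
      · have hj : x j = false := by simpa [hi] using hx
        rw [Finset.prod_eq_zero (Finset.mem_univ j)]
        simp [hj]
      · rw [Finset.prod_eq_zero (Finset.mem_univ i)]
        simp [hi]
  simp_rw [h]
  rw [sum_prod_word fun l b => ((if b then p else 1 - p) * letterKernel ε b true *
        ((if l = i ∧ b = true then 0 else 1) * (if l = j ∧ b = false then 0 else 1)))]
  obtain ⟨m, rfl⟩ := Fin.exists_succAbove_eq hij.symm
  rw [Fin.prod_univ_succAbove _ i, Fin.prod_univ_succAbove _ m]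
  simp [letterKernel, Fin.succAbove_ne]
  ring

lemma sum_wordWeight_mul_holeShift (p : ℝ) {i j : Fin (n + 2)} (hij : i ≠ j)
    (ht : t * ε * ((p + (1 - p) * ε) ^ n - p ^ n) = p ^ n * (1 - ε)) :
    ∑ x, wordWeight p x * holeShift ε t i j x = 0 := by
  have h : ∀ x : Fin (n + 2) → Bool, wordWeight p x * holeShift ε t i j x =
      t * (if x i = false ∧ x j = true then wordWeight p x * wordKernel ε x ⊤ else 0) +
      (if x = holeWord i then wordWeight p x * (-(1 - ε) - t * wordKernel ε x ⊤) else 0) := by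
    intro x
    unfold holeShift
    by_cases hx : x = holeWord i
    · subst hx
      simp only [if_true, holeWord_self, holeWord_of_ne hij.symm, and_self]
      ring
    · simp only [hx, if_false]
      split_ifs <;> ring
  simp_rw [h]
  rw [Finset.sum_add_distrib, ← Finset.mul_sum, sum_wordWeight_mul_wordKernel_top p hij,
    Finset.sum_ite_eq' Finset.univ (holeWord i), if_pos (Finset.mem_univ _), wordWeight_holeWord,
    wordKernel_holeWord, if_pos rfl, if_neg (holeWord_ne_top i).symm]
  linear_combination (1 - p) * p * ht

lemma exists_block_coupling {p p' : ℝ} (hp : 0 < p) (hpp' : p < p') (hp' : p' < 1) :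
    ∃ (n : ℕ) (k : (Fin (n + 2) → Bool) → (Fin (n + 2) → Bool) → ℝ),
      (∀ x y, 0 ≤ k x y) ∧ (∀ x y, k x y ≠ 0 → x ≤ y) ∧ (∀ x, ∑ y, k x y = 1) ∧
      (∀ y, ∑ x, wordWeight p x * k x y = wordWeight p' y) ∧
      k (holeWord 0) = k (holeWord 1) := by
  have hp1 : 0 < 1 - p := by linarith
  set ε := (p' - p) / (1 - p) with hε
  have hε0 : 0 < ε := div_pos (by linarith) hp1
  have hε1 : ε < 1 := by rw [hε, div_lt_one hp1]; linarith
  have hq : p + (1 - p) * ε = p' := by rw [hε]; field_simp; ring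
  obtain ⟨n, hn⟩ := exists_pow_lt_of_lt_one hε0 ((div_lt_one (hp.trans hpp')).2 hpp')
  have hpn : 0 < p' ^ n := pow_pos (hp.trans hpp') n
  have hpn' : 0 < p ^ n := pow_pos hp n
  rw [div_pow, div_lt_iff₀ hpn] at hn
  have hd : 0 < ε * (p' ^ n - p ^ n) := mul_pos hε0 (by nlinarith)
  set t := p ^ n * (1 - ε) / (ε * (p' ^ n - p ^ n)) with ht
  have ht0 : 0 ≤ t := div_nonneg (mul_nonneg hpn'.le (by linarith)) hd.le
  have ht1 : t ≤ 1 := by rw [ht, div_le_one hd]; nlinarith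
  have hteq : t * ε * ((p + (1 - p) * ε) ^ n - p ^ n) = p ^ n * (1 - ε) := by
    rw [hq, mul_assoc, ht, div_mul_cancel₀ _ hd.ne']
  have h01 : (0 : Fin (n + 2)) ≠ 1 := by simp
  have hh01 : holeWord (0 : Fin (n + 2)) ≠ holeWord 1 := fun h => h01 (holeWord_injective h)
  let e : (Fin (n + 2) → Bool) → (Fin (n + 2) → Bool) → ℝ := fun z y => if y = z then 1 else 0
  have he : ∀ z, ∑ y, e z y = 1 := fun z => by simp [e]
  let k : (Fin (n + 2) → Bool) → (Fin (n + 2) → Bool) → ℝ := fun x y =>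
    wordKernel ε x y + holeShift ε t 0 1 x * (e (holeWord 0) y - e ⊤ y) +
      holeShift ε t 1 0 x * (e (holeWord 1) y - e ⊤ y)
  have hk0 : ∀ y, k (holeWord 0) y = e ⊤ y := fun y => by
    simp only [k, wordKernel_holeWord, e, holeShift, if_true, hh01, if_false,
      holeWord_self, holeWord_of_ne h01.symm, reduceCtorEq, and_false]
    split_ifs <;> ring
  have hk1 : ∀ y, k (holeWord 1) y = e ⊤ y := fun y => by
    simp only [k, wordKernel_holeWord, e, holeShift, if_true, hh01.symm, if_false,
      holeWord_self, holeWord_of_ne h01, reduceCtorEq, and_false]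
    split_ifs <;> ring
  have hshift : ∀ x : Fin (n + 2) → Bool, x ≠ holeWord 0 → x ≠ holeWord 1 → 0 ≤ holeShift ε t 0 1 x ∧
      0 ≤ holeShift ε t 1 0 x ∧
      holeShift ε t 0 1 x + holeShift ε t 1 0 x ≤ wordKernel ε x ⊤ := fun x h0 h1 => by
    have hK := wordKernel_nonneg hε0.le hε1.le x ⊤
    have := mul_nonneg ht0 hK
    have := mul_le_of_le_one_left hK ht1
    simp only [holeShift, h0, h1, if_false]
    cases x 0 <;> cases x 1 <;>
      simp only [reduceCtorEq, and_self, and_false, false_and, if_true, if_false] <;>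
      refine ⟨?_, ?_, ?_⟩ <;> linarith
  refine ⟨n, k, fun x y => ?_, fun x y hxy => ?_, fun x => ?_, fun y => ?_, ?_⟩
  · by_cases h0 : x = holeWord 0
    · rw [h0, hk0]; simp only [e]; split_ifs <;> simp
    by_cases h1 : x = holeWord 1
    · rw [h1, hk1]; simp only [e]; split_ifs <;> simp
    obtain ⟨ha, hb, hab⟩ := hshift x h0 h1
    by_cases hy : y = ⊤
    · subst hy
      simp only [k, e, (holeWord_ne_top _).symm, if_true, if_false]
      linarith
    · simp only [k, e, hy, if_false, sub_zero]
      have := wordKernel_nonneg hε0.le hε1.le x y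
      have h1 : ∀ z : Fin (n + 2) → Bool, (0 : ℝ) ≤ if y = z then 1 else 0 := fun z => by
        split_ifs <;> simp
      have := mul_nonneg ha (h1 (holeWord 0))
      have := mul_nonneg hb (h1 (holeWord 1))
      linarith
  · by_contra hle
    have hy : y ≠ ⊤ := fun h => hle (h ▸ le_top)
    have hle' : ∀ i, x i = false → x ≤ holeWord i := fun i hi j => by
      by_cases hj : j = i
      · subst hj; rw [hi]; exact Bool.false_le _
      · rw [holeWord_of_ne hj]; exact Bool.le_true _
    have hs : ∀ i j, holeShift ε t i j x * (e (holeWord i) y - e ⊤ y) = 0 := fun i j => by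
      by_cases hyi : y = holeWord i
      · have hxi : x i ≠ false := fun h => hle (hyi ▸ hle' i h)
        have : x ≠ holeWord i := fun h => hxi (h ▸ holeWord_self i)
        simp [holeShift, this, hxi]
      · simp [e, hyi, hy]
    refine hle (le_of_wordKernel_ne_zero (ε := ε) fun h => hxy ?_)
    simp only [k, h, hs, add_zero]
  · simp only [k, Finset.sum_add_distrib, ← Finset.mul_sum, Finset.sum_sub_distrib, he,
      sum_wordKernel]
    ring
  · simp only [k, mul_add, Finset.sum_add_distrib, ← mul_assoc, ← Finset.sum_mul,
      sum_wordWeight_mul_wordKernel, sum_wordWeight_mul_holeShift p h01 hteq,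
      sum_wordWeight_mul_holeShift p h01.symm hteq, hq]
    ring
  · ext y
    rw [hk0, hk1]

end FiniteCoupling

section BlockMap

lemma exists_measurable_of_weights {W Y : Type*} [MeasurableSpace W] [StandardBorelSpace W]
    (ν : Measure W) [IsProbabilityMeasure ν] [NullSingletonClass ν]
    [Fintype Y] [MeasurableSpace Y] [MeasurableSingletonClass Y]
    (κ : Y → ℝ) (h0 : ∀ y, 0 ≤ κ y) (h1 : ∑ y, κ y = 1) :
    ∃ φ : W → Y, Measurable φ ∧ (∀ y, ν (φ ⁻¹' {y}) = ENNReal.ofReal (κ y)) ∧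
      ∀ w, κ (φ w) ≠ 0 := by
  classical
  obtain ⟨y₀, -, hy₀⟩ := Finset.exists_ne_zero_of_sum_ne_zero (h1 ▸ one_ne_zero :
    ∑ y, κ y ≠ 0)
  have : Nonempty Y := ⟨y₀⟩
  let ρ : Measure Y := ∑ y, ENNReal.ofReal (κ y) • Measure.dirac y
  have hρ : ∀ y, ρ {y} = ENNReal.ofReal (κ y) := fun y => by
    simp only [ρ, Measure.finsetSum_apply, Measure.smul_apply, smul_eq_mul]
    rw [Finset.sum_eq_single y]
    · simp
    · intro z _ hz
      simp [hz]
    · simp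
  have : IsProbabilityMeasure ρ := ⟨by
    simp only [ρ, Measure.finsetSum_apply, Measure.smul_apply, smul_eq_mul, measure_univ, mul_one]
    rw [← ENNReal.ofReal_sum_of_nonneg fun y _ => h0 y, h1, ENNReal.ofReal_one]⟩
  obtain ⟨u, hu, huν⟩ := exists_measurable_map_eq_volume_unitInterval ν
  obtain ⟨f, hf, hfρ⟩ := Measure.exists_measurable_map_eq ρ
  have hfu : ∀ y, ν ((f ∘ u) ⁻¹' {y}) = ENNReal.ofReal (κ y) := fun y => by
    rw [← Measure.map_apply (hf.comp hu) (MeasurableSet.singleton y), ← Measure.map_map hf hu,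
      huν, hfρ, hρ]
  let r : Y → Y := fun y => if κ y = 0 then y₀ else y
  have hae : ∀ᵐ w ∂ν, κ (f (u w)) ≠ 0 := by
    have : {w | ¬ κ (f (u w)) ≠ 0} = ⋃ y ∈ {y | κ y = 0}, (f ∘ u) ⁻¹' {y} := by
      ext w; simp
    rw [ae_iff, this, measure_biUnion_null_iff (Set.to_countable _)]
    intro y hy
    rw [hfu, show κ y = 0 from hy, ENNReal.ofReal_zero]
  refine ⟨fun w => r (f (u w)), (measurable_of_countable r).comp (hf.comp hu), fun y => ?_, fun w => ?_⟩
  · rw [← hfu]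
    refine measure_congr ?_
    filter_upwards [hae] with w hw
    exact congrArg (· = y) (if_neg hw : r (f (u w)) = f (u w))
  · simp only [r]
    split_ifs with h <;> assumption

lemma infinitePi_singleton_eq_wordWeight {r : ℝ} (h0 : 0 ≤ r) (h1 : r ≤ 1)
    [IsProbabilityMeasure (bernoulliMeasure r)] {n : ℕ} (x : Fin n → Bool) :
    (Measure.infinitePi fun _ : Fin n => bernoulliMeasure r) {x} =
      ENNReal.ofReal (wordWeight r x) := by
  rw [Measure.infinitePi_singleton_of_fintype, wordWeight, ENNReal.ofReal_prod_of_nonneg]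
  · simp only [bernoulliMeasure_singleton]
    refine Finset.prod_congr rfl fun i _ => ?_
    split_ifs <;> rfl
  · intro i _
    split_ifs <;> linarith

lemma exists_block_map {p p' : ℝ} (hp : 0 < p) (hpp' : p < p') (hp' : p' < 1)
    {W : Type*} [MeasurableSpace W] [StandardBorelSpace W]
    (ν : Measure W) [IsProbabilityMeasure ν] [NullSingletonClass ν] :
    ∃ (n : ℕ) (g : (Fin (n + 2) → Bool) → W → Fin (n + 2) → Bool),
      Measurable (Function.uncurry g) ∧ g (holeWord 0) = g (holeWord 1) ∧ (∀ x w, x ≤ g x w) ∧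
      ((Measure.infinitePi fun _ : Fin (n + 2) => bernoulliMeasure p).prod ν).map
        (Function.uncurry g) = Measure.infinitePi fun _ => bernoulliMeasure p' := by
  obtain ⟨n, k, hk0, hkle, hk1, hkp, hk⟩ := exists_block_coupling hp hpp' hp'
  have hP := isProbabilityMeasure_bernoulliMeasure hp.le (hpp'.trans hp').le
  have hP' := isProbabilityMeasure_bernoulliMeasure (hp.trans hpp').le hp'.le
  have hw0 : ∀ x : Fin (n + 2) → Bool, 0 ≤ wordWeight p x := fun x =>
    Finset.prod_nonneg fun i _ => by split_ifs <;> linarith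
  have hφ := fun κ : {κ : (Fin (n + 2) → Bool) → ℝ // (∀ y, 0 ≤ κ y) ∧ ∑ y, κ y = 1} =>
    exists_measurable_of_weights ν κ.1 κ.2.1 κ.2.2
  choose φ hφm hφν hφ0 using hφ
  let g : (Fin (n + 2) → Bool) → W → Fin (n + 2) → Bool := fun x => φ ⟨k x, hk0 x, hk1 x⟩
  have hg : Measurable (Function.uncurry g) :=
    measurable_from_prod_countable_right fun x => hφm ⟨k x, hk0 x, hk1 x⟩
  refine ⟨n, g, hg, ?_, fun x w => hkle x _ (hφ0 ⟨k x, hk0 x, hk1 x⟩ w), ?_⟩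
  · simp only [g, hk]
  · refine Measure.ext_of_singleton fun y => ?_
    rw [Measure.map_apply hg (MeasurableSet.singleton y),
      Measure.prod_apply (hg (MeasurableSet.singleton y)), lintegral_fintype,
      infinitePi_singleton_eq_wordWeight (hp.trans hpp').le hp'.le, ← hkp,
      ENNReal.ofReal_sum_of_nonneg fun x _ => mul_nonneg (hw0 x) (hk0 x y)]
    refine Finset.sum_congr rfl fun x _ => ?_
    rw [infinitePi_singleton_eq_wordWeight hp.le (hpp'.trans hp').le, ENNReal.ofReal_mul (hw0 x), mul_comm]
    congr 1
    exact hφν ⟨k x, hk0 x, hk1 x⟩ y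

end BlockMap

section RowCoins

open scoped Classical in
/-- The coin read off a row: whether `a` is the first of the letters `a`, `b` to appear. -/
noncomputable def rowCoin {X : Type*} (a b : X) (x : ℕ → X) : Bool :=
  decide (∃ j, x j = a ∧ ∀ k < j, x k ≠ a ∧ x k ≠ b)

variable {X : Type*} {a b : X}

lemma measurable_rowCoin [MeasurableSpace X] [MeasurableSingletonClass X] :
    Measurable (rowCoin a b) := by
  refine measurable_to_bool ?_
  have h : rowCoin a b ⁻¹' {true} =
      ⋃ j, ({x | x j = a} ∩ ⋂ k, ⋂ _ : k < j, ({x | x k = a}ᶜ ∩ {x | x k = b}ᶜ)) := by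
    ext x
    simp [rowCoin]
  have hm : ∀ k c, MeasurableSet {x : ℕ → X | x k = c} := fun k c =>
    (measurable_pi_apply (X := fun _ : ℕ => X) k) (MeasurableSet.singleton c)
  rw [h]
  exact .iUnion fun j => (hm j a).inter <| .iInter fun k => .iInter fun _ =>
    (hm k a).compl.inter (hm k b).compl

open scoped Classical in
lemma rowCoin_eq {x : ℕ → X} {j : ℕ} (hj : x j = a ∨ x j = b)
    (hmin : ∀ k < j, x k ≠ a ∧ x k ≠ b) : rowCoin a b x = decide (x j = a) := by
  rw [rowCoin, decide_eq_decide]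
  refine ⟨fun ⟨i, hi, h⟩ => ?_, fun h => ⟨j, h, hmin⟩⟩
  rcases lt_trichotomy i j with hij | rfl | hij
  · exact absurd hi (hmin i hij).1
  · exact hi
  · exact (hj.elim (h j hij).1 (h j hij).2).elim

lemma rowCoin_swap [DecidableEq X] (hab : a ≠ b) {x : ℕ → X} (hx : ∃ j, x j = a ∨ x j = b) :
    rowCoin a b (fun j => Equiv.swap a b (x j)) = !rowCoin a b x := by
  classical
  have hmin : ∀ k < Nat.find hx, x k ≠ a ∧ x k ≠ b := fun k hk =>
    not_or.1 (Nat.find_min hx hk)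
  have hj := Nat.find_spec hx
  rw [rowCoin_eq hj hmin, rowCoin_eq (j := Nat.find hx)]
  · rcases hj with h | h <;> simp [h, hab.symm]
  · rcases hj with h | h <;> simp [h]
  · intro k hk
    rw [Equiv.swap_apply_of_ne_of_ne (hmin k hk).1 (hmin k hk).2]
    exact hmin k hk

variable [MeasurableSpace X] [MeasurableSingletonClass X]

lemma ae_exists_eq (P : Measure X) [IsProbabilityMeasure P] (ha : P {a} ≠ 0) :
    ∀ᵐ x ∂Measure.infinitePi fun _ : ℕ => P, ∃ j, x j = a := by
  have hlt : P {a}ᶜ < 1 := by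
    rw [prob_compl_eq_one_sub (MeasurableSet.singleton a)]
    exact ENNReal.sub_lt_self ENNReal.one_ne_top one_ne_zero ha
  rw [ae_iff]
  refine le_antisymm ?_ zero_le
  refine ge_of_tendsto' (ENNReal.tendsto_pow_atTop_nhds_zero_of_lt_one hlt) fun n => ?_
  calc Measure.infinitePi (fun _ : ℕ => P) {x | ¬∃ j, x j = a}
      ≤ Measure.infinitePi (fun _ : ℕ => P) (Set.pi (Finset.range n) fun _ => {a}ᶜ) :=
        measure_mono fun x hx i _ hi => hx ⟨i, hi⟩
    _ = P {a}ᶜ ^ n := by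
        rw [Measure.infinitePi_pi _ fun _ _ => (MeasurableSet.singleton a).compl]
        simp

lemma map_swap_eq_self [Countable X] [DecidableEq X] (P : Measure X) (h : P {a} = P {b}) :
    P.map (Equiv.swap a b) = P := by
  refine Measure.ext_of_singleton fun y => ?_
  rw [Measure.map_apply (measurable_of_countable _) (MeasurableSet.singleton y),
    ← Equiv.image_symm_eq_preimage, Set.image_singleton, Equiv.symm_swap]
  by_cases hya : y = a
  · rw [hya, Equiv.swap_apply_left, h]
  by_cases hyb : y = b
  · rw [hyb, Equiv.swap_apply_right, h]
  rw [Equiv.swap_apply_of_ne_of_ne hya hyb]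

lemma map_prodMk_rowCoin [Countable X] (P : Measure X) [IsProbabilityMeasure P] (hab : a ≠ b)
    (h : P {a} = P {b}) (ha : P {a} ≠ 0) {Z : Type*} [MeasurableSpace Z] {z : X → Z}
    (hz : Measurable z) (hzab : z a = z b) :
    (Measure.infinitePi fun _ : ℕ => P).map (fun x => ((fun j => z (x j)), rowCoin a b x)) =
      (Measure.infinitePi fun _ : ℕ => P.map z).prod (_root_.bernoulliMeasure (1 / 2 : ℝ)) := by
  classical
  have := isProbabilityMeasure_bernoulliMeasure (r := 1 / 2) (by norm_num) (by norm_num)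
  have := Measure.isProbabilityMeasure_map (μ := P) hz.aemeasurable
  set ρ := Measure.infinitePi fun _ : ℕ => P
  let τ : (ℕ → X) → ℕ → X := fun x j => Equiv.swap a b (x j)
  have hsm : Measurable (Equiv.swap a b) := measurable_of_countable _
  have hτm : Measurable τ := by fun_prop
  have hτ : ρ.map τ = ρ := by
    simp only [τ, ρ]
    rw [Measure.infinitePi_map_pi (fun _ : ℕ => P) fun _ => hsm, map_swap_eq_self P h]
  let ζ : (ℕ → X) → ℕ → Z := fun x j => z (x j)
  have hζm : Measurable ζ := by fun_prop
  have hζ : ρ.map ζ = Measure.infinitePi fun _ : ℕ => P.map z :=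
    Measure.infinitePi_map_pi (fun _ : ℕ => P) fun _ => hz
  have hzs : ∀ x, z (Equiv.swap a b x) = z x := fun x => by
    rw [Equiv.swap_apply_def]
    split_ifs with h1 h2
    · rw [h1, hzab]
    · rw [h2, hzab]
    · rfl
  have hζτ : ∀ x, ζ (τ x) = ζ x := fun x => funext fun j => hzs (x j)
  have hcm : Measurable (rowCoin a b) := measurable_rowCoin
  have hflip : ∀ A, MeasurableSet A → ∀ c : Bool,
      ρ (ζ ⁻¹' A ∩ rowCoin a b ⁻¹' {c}) = ρ (ζ ⁻¹' A ∩ rowCoin a b ⁻¹' {!c}) := fun A hA c => by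
    have hms := (hζm hA).inter (hcm (MeasurableSet.singleton c))
    rw [← hτ, Measure.map_apply hτm hms, hτ]
    refine measure_congr ?_
    filter_upwards [ae_exists_eq P ha] with x ⟨j, hj⟩
    have hx := rowCoin_swap hab ⟨j, Or.inl hj⟩
    refine propext (and_congr ?_ ?_)
    · change ζ (τ x) ∈ A ↔ ζ x ∈ A
      rw [hζτ]
    · change rowCoin a b (τ x) = c ↔ rowCoin a b x = !c
      rw [hx]
      cases c <;> cases rowCoin a b x <;> simp
  have hhalf : ∀ A, MeasurableSet A → ∀ c : Bool,
      ρ (ζ ⁻¹' A ∩ rowCoin a b ⁻¹' {c}) = ρ (ζ ⁻¹' A) * _root_.bernoulliMeasure (1 / 2 : ℝ) {c} :=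
    fun A hA c => by
    have hsum := measure_inter_add_sdiff (μ := ρ) (ζ ⁻¹' A) (hcm (MeasurableSet.singleton c))
    have hd : ζ ⁻¹' A \ rowCoin a b ⁻¹' {c} = ζ ⁻¹' A ∩ rowCoin a b ⁻¹' {!c} := by
      ext x
      simp only [Set.mem_sdiff, Set.mem_inter_iff, Set.mem_preimage, Set.mem_singleton_iff]
      cases c <;> simp
    rw [hd, ← hflip A hA, ← two_mul] at hsum
    have hb : _root_.bernoulliMeasure (1 / 2 : ℝ) {c} = 2⁻¹ := by
      rw [bernoulliMeasure_singleton, ← ENNReal.ofReal_ofNat 2,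
        ← ENNReal.ofReal_inv_of_pos two_pos]
      norm_num
    rw [hb, ← hsum, mul_comm 2, mul_assoc, ENNReal.mul_inv_cancel two_ne_zero (by simp), mul_one]
  rw [← hζ]
  have := Measure.isProbabilityMeasure_map (μ := ρ) hζm.aemeasurable
  refine (Measure.prod_eq fun A B hA hB => ?_).symm
  rw [Measure.map_apply (hζm.prodMk hcm) (hA.prod hB), Measure.map_apply hζm hA]
  have heq : (ρ.restrict (ζ ⁻¹' A)).map (rowCoin a b) =
      ρ (ζ ⁻¹' A) • _root_.bernoulliMeasure (1 / 2 : ℝ) := by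
    refine Measure.ext_of_singleton fun c => ?_
    have hc := hcm (MeasurableSet.singleton c)
    rw [Measure.map_apply hcm (MeasurableSet.singleton c), Measure.restrict_apply hc,
      Set.inter_comm, hhalf A hA, Measure.smul_apply, smul_eq_mul]
  have := congrArg (fun m => m B) heq
  simp only [Measure.smul_apply, smul_eq_mul] at this
  rw [← this, Measure.map_apply hcm hB, Measure.restrict_apply (hcm hB), Set.inter_comm]
  rfl

lemma exists_factor_of_block_map [Countable X] (P : Measure X) [IsProbabilityMeasure P]
    (hab : a ≠ b) (h : P {a} = P {b}) (ha : P {a} ≠ 0) {Y : Type*} [MeasurableSpace Y]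
    {g : X → (ℕ → Bool) → Y} (hg : Measurable (Function.uncurry g)) (hgab : g a = g b) :
    ∃ F : (ℕ × ℕ → X) → ℕ × ℕ → Y, Measurable F ∧
      (Measure.infinitePi fun _ : ℕ × ℕ => P).map F = (Measure.infinitePi fun _ : ℕ × ℕ =>
        (P.prod (Measure.infinitePi fun _ : ℕ => _root_.bernoulliMeasure (1 / 2 : ℝ))).map
          (Function.uncurry g)) ∧
      ∀ x c, ∃ w, F x c = g (x c) w := by
  classical
  have := isProbabilityMeasure_bernoulliMeasure (r := 1 / 2) (by norm_num) (by norm_num)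
  let z : X → X := fun x => if x = b then a else x
  have hz : Measurable z := measurable_of_countable z
  have hzab : z a = z b := by simp [z]
  have hgz : ∀ x, g (z x) = g x := fun x => by
    simp only [z]
    split_ifs with h
    · rw [h, hgab]
    · rfl
  have := Measure.isProbabilityMeasure_map (μ := P) hz.aemeasurable
  set β := _root_.bernoulliMeasure (1 / 2 : ℝ)
  let e : (ℕ × ℕ) × ℕ ≃ ℕ := Denumerable.eqv _
  let rows : (ℕ × ℕ → X) → ℕ → (ℕ → X) × Bool := fun x i =>
    ((fun j => z (x (i, j))), rowCoin a b fun j => x (i, j))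
  let unzip : (ℕ → (ℕ → X) × Bool) → (ℕ → ℕ → X) × (ℕ → Bool) := fun s =>
    ((fun i => (s i).1), fun i => (s i).2)
  let regroup : (ℕ → ℕ → X) × (ℕ → Bool) → (ℕ × ℕ → X) × (ℕ × ℕ → ℕ → Bool) :=
    Prod.map (fun u c => u c.1 c.2) fun w c k => w (e (c, k))
  let cells : (ℕ × ℕ → X) × (ℕ × ℕ → ℕ → Bool) → ℕ × ℕ → X × (ℕ → Bool) := fun s c =>
    (s.1 c, s.2 c)
  let out : (ℕ × ℕ → X × (ℕ → Bool)) → ℕ × ℕ → Y := fun s c => Function.uncurry g (s c)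
  have hpair : Measurable fun x : ℕ → X => ((fun j => z (x j)), rowCoin a b x) :=
    Measurable.prodMk (by fun_prop) measurable_rowCoin
  have hrows : Measurable rows := measurable_pi_lambda _ fun i => hpair.comp (by fun_prop)
  have hunzip : Measurable unzip := by fun_prop
  have hregroup : Measurable regroup := by fun_prop
  have hcells : Measurable cells := by fun_prop
  have hout : Measurable out := by fun_prop
  refine ⟨out ∘ cells ∘ regroup ∘ unzip ∘ rows,
    hout.comp (hcells.comp (hregroup.comp (hunzip.comp hrows))), ?_,
    fun x c => ⟨fun k => (rows x (e (c, k))).2, congrFun (hgz (x c)) _⟩⟩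
  have hrows_map : (Measure.infinitePi fun _ : ℕ × ℕ => P).map rows =
      Measure.infinitePi fun _ : ℕ =>
        (Measure.infinitePi fun _ : ℕ => P.map z).prod β := by
    have hrow : Measurable fun (x : ℕ → ℕ → X) i => ((fun j => z (x i j)), rowCoin a b (x i)) :=
      measurable_pi_lambda _ fun i => hpair.comp (measurable_pi_apply i)
    rw [← map_prodMk_rowCoin P hab h ha hz hzab,
      ← Measure.infinitePi_map_pi (fun _ : ℕ => Measure.infinitePi fun _ : ℕ => P) fun _ => hpair,
      ← Measure.infinitePi_map_curry fun _ _ => P,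
      Measure.map_map hrow (by fun_prop)]
    rfl
  have hunzip_map : (Measure.infinitePi fun _ : ℕ =>
        (Measure.infinitePi fun _ : ℕ => P.map z).prod β).map unzip =
      (Measure.infinitePi fun _ : ℕ => Measure.infinitePi fun _ : ℕ => P.map z).prod
        (Measure.infinitePi fun _ : ℕ => β) := by
    rw [← map_zip_infinitePi, Measure.map_map hunzip (by fun_prop)]
    exact Measure.map_id
  have hregroup_map : ((Measure.infinitePi fun _ : ℕ => Measure.infinitePi fun _ : ℕ => P.map z).prod
        (Measure.infinitePi fun _ : ℕ => β)).map regroup =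
      (Measure.infinitePi fun _ : ℕ × ℕ => P.map z).prod
        (Measure.infinitePi fun _ : ℕ × ℕ => Measure.infinitePi fun _ : ℕ => β) := by
    rw [← Measure.map_prod_map _ _ (by fun_prop) (by fun_prop)]
    congr 1
    · rw [← Measure.infinitePi_map_curry fun _ _ => P.map z,
        Measure.map_map (by fun_prop) (by fun_prop)]
      exact Measure.map_id
    · rw [← Measure.infinitePi_map_curry fun _ _ => β,
        ← Measure.map_infinitePi_infinitePi_of_inj (P := fun _ => β) e.injective,
        Measure.map_map (by fun_prop) (by fun_prop)]
      rfl
  have hfun : Function.uncurry g ∘ Prod.map z id = Function.uncurry g := by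
    ext ⟨x, w⟩
    exact congrFun (hgz x) w
  rw [← Measure.map_map hout (by fun_prop), ← Measure.map_map hcells (by fun_prop),
    ← Measure.map_map hregroup (by fun_prop), ← Measure.map_map hunzip hrows, hrows_map,
    hunzip_map, hregroup_map, map_zip_infinitePi, Measure.infinitePi_map_pi _ fun _ => hg]
  congr 1
  ext1 c
  conv_rhs => rw [← hfun, ← Measure.map_map hg (by fun_prop),
    ← Measure.map_prod_map _ _ hz measurable_id, Measure.map_id]

end RowCoins

lemma exists_thickening_of_countable {p p' : ℝ} (hp : 0 < p) (hpp' : p < p') (hp' : p' < 1)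
    (Q : Type*) [Countable Q] [Infinite Q] :
    ∃ F : (Q → Bool) → Q → Bool, Measurable F ∧
      (Measure.infinitePi fun _ : Q => bernoulliMeasure p).map F =
        Measure.infinitePi (fun _ : Q => bernoulliMeasure p') ∧ ∀ x, x ≤ F x := by
  have := isProbabilityMeasure_bernoulliMeasure hp.le (hpp'.trans hp').le
  have := isProbabilityMeasure_bernoulliMeasure (hp.trans hpp').le hp'.le
  have := isProbabilityMeasure_bernoulliMeasure (r := 1 / 2) (by norm_num) (by norm_num)
  have : NullSingletonClass (Measure.infinitePi fun _ : ℕ => _root_.bernoulliMeasure (1 / 2)) := by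
    refine nullSingletonClass_infinitePi_of_le (c := ENNReal.ofReal (1 / 2)) _ ?_ fun b => ?_
    · rw [ENNReal.ofReal_lt_one]; norm_num
    · rw [bernoulliMeasure_singleton]
      norm_num
  obtain ⟨n, g, hg, hg01, hle, hgmap⟩ := exists_block_map hp hpp' hp'
    (Measure.infinitePi fun _ : ℕ => _root_.bernoulliMeasure (1 / 2))
  have h01 : holeWord (0 : Fin (n + 2)) ≠ holeWord 1 := fun h => by
    simpa using holeWord_injective h
  obtain ⟨F, hF, hFmap, hFg⟩ := exists_factor_of_block_map
    (Measure.infinitePi fun _ : Fin (n + 2) => bernoulliMeasure p) h01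
    (by simp only [infinitePi_singleton_eq_wordWeight hp.le (hpp'.trans hp').le,
      wordWeight_holeWord])
    (by
      rw [infinitePi_singleton_eq_wordWeight hp.le (hpp'.trans hp').le, wordWeight_holeWord, ne_eq,
        ENNReal.ofReal_eq_zero, not_le]
      exact mul_pos (by linarith) (pow_pos hp _)) hg hg01
  obtain ⟨e⟩ := nonempty_equiv_of_countable (α := (ℕ × ℕ) × Fin (n + 2)) (β := Q)
  have hsplit : ∀ {r : ℝ} [IsProbabilityMeasure (bernoulliMeasure r)],
      (Measure.infinitePi fun _ : Q => bernoulliMeasure r).map (fun x c i => x (e (c, i))) =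
        Measure.infinitePi fun _ : ℕ × ℕ =>
          Measure.infinitePi fun _ : Fin (n + 2) => bernoulliMeasure r := fun {r} _ => by
    rw [← Measure.infinitePi_map_curry fun _ _ => bernoulliMeasure r,
      ← Measure.map_infinitePi_infinitePi_of_inj (P := fun _ => bernoulliMeasure r) e.injective,
      Measure.map_map (by fun_prop) (by fun_prop)]
    rfl
  let merge : (ℕ × ℕ → Fin (n + 2) → Bool) → Q → Bool := fun y q => y (e.symm q).1 (e.symm q).2
  have hmerge : Measurable merge := by fun_prop
  refine ⟨fun x => merge (F fun c i => x (e (c, i))), by fun_prop, ?_, fun x q => ?_⟩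
  · have : (fun x : Q → Bool => merge (F fun c i => x (e (c, i)))) =
        merge ∘ F ∘ fun (x : Q → Bool) c i => x (e (c, i)) := rfl
    rw [this, ← Measure.map_map hmerge (by fun_prop), ← Measure.map_map hF (by fun_prop), hsplit,
      hFmap, hgmap, ← hsplit, Measure.map_map hmerge (by fun_prop)]
    have : (merge ∘ fun (x : Q → Bool) c i => x (e (c, i))) = id := by
      ext x q
      simp [merge]
    rw [this, Measure.map_id]
  · obtain ⟨w, hw⟩ := hFg (fun c i => x (e (c, i))) (e.symm q).1
    have := hle (fun i => x (e ((e.symm q).1, i))) w (e.symm q).2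
    simp only [merge, hw]
    simpa using this

lemma exists_equivariant_thickening {p p' : ℝ} (hp : 0 < p) (hpp' : p < p') (hp' : p' < 1)
    {G : Type*} [AddCommGroup G] [Countable G] (L : AddSubgroup G) [Infinite (G ⧸ L)] :
    ∃ f : (G → Bool) → G → Bool, Measurable f ∧
      (∀ u ∈ L, ∀ x : G → Bool, f (fun i => x (i + u)) = fun i => f x (i + u)) ∧
      (Measure.infinitePi fun _ : G => bernoulliMeasure p).map f =
        Measure.infinitePi (fun _ : G => bernoulliMeasure p') ∧ ∀ x, x ≤ f x := by
  have := isProbabilityMeasure_bernoulliMeasure hp.le (hpp'.trans hp').le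
  have := isProbabilityMeasure_bernoulliMeasure (hp.trans hpp').le hp'.le
  have : Countable (G ⧸ L) := Quotient.countable
  obtain ⟨F, hF, hFmap, hle⟩ := exists_thickening_of_countable hp hpp' hp' (G ⧸ L)
  have hout : ∀ i : G, i - (i : G ⧸ L).out ∈ L := fun i => by
    rw [← QuotientAddGroup.eq_zero_iff, QuotientAddGroup.mk_sub, QuotientAddGroup.out_eq', sub_self]
  have hmk : ∀ (q : G ⧸ L) (l : L), ((q.out + l : G) : G ⧸ L) = q := fun q l => by
    rw [QuotientAddGroup.mk_add, QuotientAddGroup.out_eq', (QuotientAddGroup.eq_zero_iff _).2 l.2,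
      add_zero]
  let e : L × (G ⧸ L) ≃ G :=
    { toFun := fun r => r.2.out + r.1
      invFun := fun i => (⟨i - (i : G ⧸ L).out, hout i⟩, i)
      left_inv := fun ⟨l, q⟩ => by
        refine Prod.ext (Subtype.ext ?_) (hmk q l)
        simp only [hmk, add_sub_cancel_left]
      right_inv := fun i => by simp }
  have hsplit : ∀ {r : ℝ} [IsProbabilityMeasure (bernoulliMeasure r)],
      (Measure.infinitePi fun _ : G => bernoulliMeasure r).map (fun x l q => x (e (l, q))) =
        Measure.infinitePi fun _ : L => Measure.infinitePi fun _ : G ⧸ L => bernoulliMeasure r :=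
      fun {r} _ => by
    rw [← Measure.infinitePi_map_curry fun _ _ => bernoulliMeasure r,
      ← Measure.map_infinitePi_infinitePi_of_inj (P := fun _ => bernoulliMeasure r) e.injective,
      Measure.map_map (by fun_prop) (by fun_prop)]
    rfl
  let merge : (L → G ⧸ L → Bool) → G → Bool := fun y i => y (e.symm i).1 (e.symm i).2
  have hmerge : Measurable merge := by fun_prop
  refine ⟨fun x => merge fun l => F fun q => x (e (l, q)), by fun_prop, fun u hu x => ?_, ?_,
    fun x i => ?_⟩
  · ext i
    have hi : ((i + u : G) : G ⧸ L) = i := by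
      rw [QuotientAddGroup.mk_add, (QuotientAddGroup.eq_zero_iff _).2 hu, add_zero]
    have hl : ((e.symm (i + u)).1 : G) = (e.symm i).1 + u := by
      change i + u - ((i + u : G) : G ⧸ L).out = i - (i : G ⧸ L).out + u
      rw [hi]
      abel
    change F _ (i : G ⧸ L) = F _ ((i + u : G) : G ⧸ L)
    rw [hi]
    congr 2
    ext q
    change x (q.out + _ + u) = x (q.out + _)
    rw [hl, add_assoc]
  · have : (fun x : G → Bool => merge fun l => F fun q => x (e (l, q))) =
        merge ∘ (fun (y : L → G ⧸ L → Bool) l => F (y l)) ∘ fun (x : G → Bool) l q => x (e (l, q)) := rfl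
    rw [this, ← Measure.map_map hmerge (by fun_prop), ← Measure.map_map (by fun_prop) (by fun_prop),
      hsplit, Measure.infinitePi_map_pi _ fun _ => hF, hFmap, ← hsplit,
      Measure.map_map hmerge (by fun_prop)]
    have : (merge ∘ fun (x : G → Bool) l q => x (e (l, q))) = id := by
      ext x q
      simp [merge]
    rw [this, Measure.map_id]
  · have := hle (fun q => x (e ((e.symm i).1, q))) (e.symm i).2
    simpa [merge] using this

lemma infinite_quotient_span {d : ℕ} (hd : 1 ≤ d) (v : Fin (d - 1) → (Fin d → ℤ)) :
    Infinite ((Fin d → ℤ) ⧸ (Submodule.span ℤ (Set.range v)).toAddSubgroup) := by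
  rw [← not_finite_iff_infinite]
  intro h
  have h1 := (Submodule.finiteQuotient_iff (Submodule.span ℤ (Set.range v))).1 h
  have h2 := finrank_range_le_card (R := ℤ) v
  rw [Set.finrank, h1, Module.finrank_fin_fun, Fintype.card_fin] at h2
  omega

/-- For `d ≥ 1` and any `0 < p < p' < 1`, there is a discrete thickening from density `p`
to density `p'` on `{0,1}^{ℤ^d}` commuting with a given `(d-1)`-dimensional lattice of shifts. -/
theorem thickening_commuting_with_sublattice (d : ℕ) (hd : 1 ≤ d) (p p' : ℝ)
    (hp : 0 < p) (hpp' : p < p') (hp' : p' < 1)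
    (v : Fin (d - 1) → (Fin d → ℤ)) (hv : LinearIndependent ℤ v) :
    ∃ f : ((Fin d → ℤ) → Bool) → ((Fin d → ℤ) → Bool), Measurable f ∧
      (∀ u ∈ Submodule.span ℤ (Set.range v), ∀ x : (Fin d → ℤ) → Bool,
        f (fun i => x (i + u)) = fun i => f x (i + u)) ∧
      ∀ μ : Measure ((Fin d → ℤ) → Bool), IsBernoulliProduct p μ →
        IsBernoulliProduct p' (μ.map f) ∧ ∀ᵐ x ∂μ, ∀ i : Fin d → ℤ, x i ≤ f x i := by
  have := isProbabilityMeasure_bernoulliMeasure hp.le (hpp'.trans hp').le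
  have := isProbabilityMeasure_bernoulliMeasure (hp.trans hpp').le hp'.le
  have := infinite_quotient_span hd v
  obtain ⟨f, hf, hfL, hfmap, hle⟩ := exists_equivariant_thickening hp hpp' hp'
    (Submodule.span ℤ (Set.range v)).toAddSubgroup
  refine ⟨f, hf, hfL, fun μ hμ => ⟨?_, Filter.Eventually.of_forall hle⟩⟩
  rw [hμ.eq_infinitePi, hfmap]
  exact isBernoulliProduct_infinitePi p'
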